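/- For all odd primes p < q < r < s < t < u, C_{pqrstu} ≤ (10935/131072)·p^{15}q^{7}r^{3}s, where C_n denotes the height of the polynomial (X^n − 1)/Φ_n(X). -/

import Mathlib

open Polynomial

/-- The height of an integer polynomial: the maximum of the absolute values of its
coefficients (`0` for the zero polynomial). -/
noncomputable def polyHeight (f : ℤ[X]) : ℕ := f.support.sup fun m => (f.coeff m).natAbs

/-- `C n` is the height of the polynomial `(X^n - 1) / Φ_n(X)` (exact division,
realized via division by the monic polynomial `Φ_n`). -/
noncomputable def Cinv (n : ℕ) : ℕ := polyHeight ((X ^ n - 1) /ₘ cyclotomic n ℤ)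

/-- The sum of the absolute values of the coefficients of an integer polynomial. -/
noncomputable def polyLength (f : ℤ[X]) : ℤ := f.sum fun _ a => |a|

theorem polyLength_eq_sum_range {f : ℤ[X]} {N : ℕ} (h : f.natDegree < N) :
    polyLength f = ∑ i ∈ Finset.range N, |f.coeff i| :=
  f.sum_over_range' (fun _ => abs_zero) N h

theorem polyLength_nonneg (f : ℤ[X]) : 0 ≤ polyLength f :=
  Finset.sum_nonneg fun _ _ => abs_nonneg _

theorem polyLength_add_le (f g : ℤ[X]) : polyLength (f + g) ≤ polyLength f + polyLength g := by
  have hf : f.natDegree < max f.natDegree g.natDegree + 1 := by omega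
  have hg : g.natDegree < max f.natDegree g.natDegree + 1 := by omega
  have hfg : (f + g).natDegree < max f.natDegree g.natDegree + 1 :=
    Nat.lt_succ_of_le (natDegree_add_le f g)
  rw [polyLength_eq_sum_range hf, polyLength_eq_sum_range hg, polyLength_eq_sum_range hfg,
    ← Finset.sum_add_distrib]
  exact Finset.sum_le_sum fun i _ => by rw [coeff_add]; exact abs_add_le _ _

theorem polyLength_neg (f : ℤ[X]) : polyLength (-f) = polyLength f := by
  simp [polyLength, Polynomial.sum_def]

theorem polyLength_sub_le (f g : ℤ[X]) : polyLength (f - g) ≤ polyLength f + polyLength g := by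
  rw [sub_eq_add_neg, ← polyLength_neg g]
  exact polyLength_add_le _ _

theorem polyLength_sum_le {ι : Type*} (s : Finset ι) (f : ι → ℤ[X]) :
    polyLength (∑ i ∈ s, f i) ≤ ∑ i ∈ s, polyLength (f i) := by
  induction s using Finset.cons_induction with
  | empty => simp [polyLength]
  | cons a s ha ih =>
    rw [Finset.sum_cons, Finset.sum_cons]
    exact (polyLength_add_le _ _).trans (by gcongr)

theorem polyLength_X_pow (n : ℕ) : polyLength (X ^ n) = 1 := by
  rw [polyLength, X_pow_eq_monomial, sum_monomial_index _ _ abs_zero, abs_one]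

theorem polyLength_sum_X_pow_le {ι : Type*} (s : Finset ι) (e : ι → ℕ) :
    polyLength (∑ i ∈ s, X ^ e i) ≤ s.card := by
  refine (polyLength_sum_le _ _).trans ?_
  simp [polyLength_X_pow]

theorem abs_coeff_mul_le {f : ℤ[X]} {A : ℤ} (hA : ∀ n, |f.coeff n| ≤ A) (g : ℤ[X]) (n : ℕ) :
    |(f * g).coeff n| ≤ A * polyLength g := by
  have hA0 : 0 ≤ A := (abs_nonneg _).trans (hA 0)
  rw [mul_comm f g, coeff_mul, polyLength_eq_sum_range (N := max (g.natDegree + 1) (n + 1)) (by omega),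
    Finset.Nat.sum_antidiagonal_eq_sum_range_succ (fun i j => g.coeff i * f.coeff j),
    Finset.mul_sum]
  refine (Finset.abs_sum_le_sum_abs _ _).trans ?_
  refine (Finset.sum_le_sum (g := fun i => A * |g.coeff i|) fun i _ => ?_).trans
    (Finset.sum_le_sum_of_subset_of_nonneg
      (Finset.range_subset_range.2 (le_max_right _ _)) fun i _ _ => by positivity)
  rw [abs_mul, mul_comm]
  exact mul_le_mul_of_nonneg_right (hA _) (abs_nonneg _)

theorem polyLength_monomial_mul (k : ℕ) (a : ℤ) (g : ℤ[X]) :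
    polyLength (monomial k a * g) ≤ |a| * polyLength g := by
  have hd : (monomial k a * g).natDegree < k + (g.natDegree + 1) := by
    have := natDegree_mul_le (p := monomial k a) (q := g)
    have := natDegree_monomial_le a (m := k)
    omega
  rw [polyLength_eq_sum_range hd, polyLength_eq_sum_range (Nat.lt_succ_self g.natDegree),
    Finset.sum_range_add, Finset.mul_sum]
  have h0 : ∑ x ∈ Finset.range k, |(monomial k a * g).coeff x| = 0 := by
    refine Finset.sum_eq_zero fun x hx => ?_
    rw [Finset.mem_range] at hx
    rw [← C_mul_X_pow_eq_monomial, mul_assoc, coeff_C_mul, coeff_X_pow_mul', if_neg (by omega)]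
    simp
  rw [h0, zero_add]
  refine (Finset.sum_le_sum fun x _ => ?_)
  rw [← C_mul_X_pow_eq_monomial, mul_assoc, coeff_C_mul, coeff_X_pow_mul', if_pos (by omega),
    abs_mul, Nat.add_sub_cancel_left]

theorem polyLength_mul_le (f g : ℤ[X]) : polyLength (f * g) ≤ polyLength f * polyLength g := by
  conv_lhs => rw [← f.sum_monomial_eq, Polynomial.sum_def, Finset.sum_mul]
  refine (polyLength_sum_le _ _).trans ?_
  rw [polyLength, Polynomial.sum_def, Finset.sum_mul]
  exact Finset.sum_le_sum fun i _ => polyLength_monomial_mul _ _ _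

theorem polyLength_expand_le (r : ℕ) (f : ℤ[X]) : polyLength (expand ℤ r f) ≤ polyLength f := by
  rw [expand_eq_sum, Polynomial.sum_def]
  refine (polyLength_sum_le _ _).trans ?_
  conv_rhs => rw [polyLength, Polynomial.sum_def]
  refine Finset.sum_le_sum fun i _ => ?_
  rw [← pow_mul, C_mul_X_pow_eq_monomial, polyLength, sum_monomial_index _ _ abs_zero]

/-- Expansion of a quotient `f(X^r) g(X) / (1 - X^m)` into a triple sum. -/
theorem coeff_eq_sum_of_mul_one_sub {F : PowerSeries ℤ} {f g : ℤ[X]} {m r I J K n : ℕ}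
    (h : F * (1 - PowerSeries.X ^ m) = ((expand ℤ r f * g : ℤ[X]) : PowerSeries ℤ))
    (hI : f.natDegree < I) (hJ : g.natDegree < J) (hK : n < m * K) :
    PowerSeries.coeff n F = ∑ i ∈ Finset.range I, ∑ j ∈ Finset.range J, ∑ k ∈ Finset.range K,
      if r * i + j + m * k = n then f.coeff i * g.coeff j else 0 := by
  have hgeom : F * (1 - PowerSeries.X ^ (m * K)) =
      ((expand ℤ r f * g * ∑ k ∈ Finset.range K, X ^ (m * k) : ℤ[X]) : PowerSeries ℤ) := by
    have e : (1 - PowerSeries.X ^ (m * K) : PowerSeries ℤ) =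
        (1 - PowerSeries.X ^ m) * ((∑ k ∈ Finset.range K, X ^ (m * k) : ℤ[X]) : PowerSeries ℤ) := by
      have := mul_neg_geom_sum (X ^ m : ℤ[X]) K
      simp only [← pow_mul] at this
      have := congrArg (fun P : ℤ[X] => (P : PowerSeries ℤ)) this
      simpa using this.symm
    rw [e, ← mul_assoc, h, ← Polynomial.coe_mul]
  have hsum : expand ℤ r f * g * ∑ k ∈ Finset.range K, X ^ (m * k) =
      ∑ i ∈ Finset.range I, ∑ j ∈ Finset.range J, ∑ k ∈ Finset.range K,
        C (f.coeff i * g.coeff j) * X ^ (r * i + j + m * k) := by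
    conv_lhs => rw [f.as_sum_range' I hI, g.as_sum_range' J hJ]
    rw [map_sum, Finset.sum_mul_sum, Finset.sum_mul]
    refine Finset.sum_congr rfl fun i _ => ?_
    rw [Finset.sum_mul]
    refine Finset.sum_congr rfl fun j _ => ?_
    rw [Finset.mul_sum]
    refine Finset.sum_congr rfl fun k _ => ?_
    rw [expand_monomial, monomial_mul_monomial, ← C_mul_X_pow_eq_monomial, mul_assoc, ← pow_add,
      mul_comm r i]
  have h1 := congrArg (PowerSeries.coeff n) hgeom
  rw [mul_sub, mul_one, map_sub, PowerSeries.coeff_mul_X_pow', if_neg (by omega), sub_zero,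
    Polynomial.coeff_coe, hsum] at h1
  rw [h1]
  simp only [finsetSum_coeff, coeff_C_mul_X_pow]
  exact Finset.sum_congr rfl fun i _ => Finset.sum_congr rfl fun j _ =>
    Finset.sum_congr rfl fun k _ => by simp only [eq_comm]

theorem sum_ite_mul_add_le_one {m r : ℕ} (hm : 0 < m) (hr : Nat.Coprime m r) (j n K : ℕ) :
    ∑ i ∈ Finset.range m, ∑ k ∈ Finset.range K,
      (if r * i + j + m * k = n then 1 else 0 : ℤ) ≤ 1 := by
  rw [← Finset.sum_product', Finset.sum_boole]
  norm_cast
  rw [Finset.card_le_one]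
  rintro ⟨i, k⟩ h ⟨i', k'⟩ h'
  simp only [Finset.mem_filter, Finset.mem_product, Finset.mem_range] at h h'
  have hmod : r * i ≡ r * i' [MOD m] := by
    have : r * i + m * k = r * i' + m * k' := by omega
    simpa [Nat.ModEq] using congrArg (· % m) this
  have hi : i = i' :=
    Nat.ModEq.eq_of_lt_of_lt (Nat.ModEq.cancel_left_of_coprime hr hmod) h.1.1 h'.1.1
  subst hi
  have : m * k = m * k' := by omega
  rw [Nat.eq_of_mul_eq_mul_left hm this]

theorem abs_coeff_le_of_mul_one_sub {F : PowerSeries ℤ} {f g : ℤ[X]} {m r : ℕ} {A : ℤ}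
    (h : F * (1 - PowerSeries.X ^ m) = ((expand ℤ r f * g : ℤ[X]) : PowerSeries ℤ))
    (hr : Nat.Coprime m r) (hf : f.natDegree < m) (hA : ∀ i, |f.coeff i| ≤ A) (n : ℕ) :
    |PowerSeries.coeff n F| ≤ A * polyLength g := by
  have hA0 : 0 ≤ A := (abs_nonneg _).trans (hA 0)
  have hm : 0 < m := by omega
  rw [coeff_eq_sum_of_mul_one_sub h hf (Nat.lt_succ_self _) (K := n + 1) (by nlinarith),
    Finset.sum_comm, polyLength_eq_sum_range (Nat.lt_succ_self _), Finset.mul_sum]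
  refine (Finset.abs_sum_le_sum_abs _ _).trans (Finset.sum_le_sum fun j _ => ?_)
  calc |∑ i ∈ Finset.range m, ∑ k ∈ Finset.range (n + 1),
        if r * i + j + m * k = n then f.coeff i * g.coeff j else 0|
      ≤ ∑ i ∈ Finset.range m, ∑ k ∈ Finset.range (n + 1),
        (A * |g.coeff j|) * (if r * i + j + m * k = n then 1 else 0 : ℤ) := by
        refine (Finset.abs_sum_le_sum_abs _ _).trans (Finset.sum_le_sum fun i _ => ?_)
        refine (Finset.abs_sum_le_sum_abs _ _).trans (Finset.sum_le_sum fun k _ => ?_)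
        split_ifs
        · rw [abs_mul, mul_one]
          exact mul_le_mul_of_nonneg_right (hA i) (abs_nonneg _)
        · simp
    _ ≤ A * |g.coeff j| := by
        simp only [← Finset.mul_sum]
        exact mul_le_of_le_one_right (by positivity) (sum_ite_mul_add_le_one hm hr j n _)

theorem sum_ite_add_mul_le {m a D K : ℕ} (hm : 0 < m) :
    (m : ℤ) * ∑ n ∈ Finset.range (D + 1), ∑ k ∈ Finset.range K,
      (if a + m * k = n then 1 else 0 : ℤ) ≤ max 0 ((D : ℤ) - a + m) := by
  rw [Finset.sum_comm]
  have hk : ∀ k ∈ Finset.range K, (∑ n ∈ Finset.range (D + 1),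
      (if a + m * k = n then 1 else 0 : ℤ)) = if a + m * k < D + 1 then 1 else 0 := by
    intro k _
    rw [Finset.sum_ite_eq]
    simp
  rw [Finset.sum_congr rfl hk, Finset.sum_boole]
  by_cases haD : a ≤ D
  · refine le_trans ?_ (le_max_right _ _)
    have hsub : (Finset.range K).filter (fun k => a + m * k < D + 1) ⊆
        Finset.range ((D - a) / m + 1) := by
      intro k hk
      simp only [Finset.mem_filter, Finset.mem_range] at hk ⊢
      rw [Nat.lt_succ_iff, Nat.le_div_iff_mul_le hm]
      have := mul_comm m k
      omega
    have hc := Finset.card_le_card hsub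
    rw [Finset.card_range] at hc
    have h2 : m * ((D - a) / m) ≤ D - a := Nat.mul_div_le _ _
    have h3 := Nat.mul_le_mul_left m hc
    rw [mul_add, mul_one] at h3
    have : m * ((Finset.range K).filter (fun k => a + m * k < D + 1)).card ≤ D - a + m := by omega
    have h4 := (Nat.cast_le (α := ℤ)).2 this
    push_cast [Nat.cast_sub haD] at h4
    exact h4
  · rw [Finset.filter_false_of_mem (fun k _ => by have := Nat.zero_le (m * k); omega)]
    simp

theorem two_mul_sum_abs_coeff_mul {f : ℤ[X]} (hf : f.reverse = f) :
    2 * ∑ i ∈ Finset.range (f.natDegree + 1), |f.coeff i| * i = f.natDegree * polyLength f := by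
  rw [polyLength_eq_sum_range (Nat.lt_succ_self _), two_mul, Finset.mul_sum]
  conv_lhs =>
    lhs
    rw [← Finset.sum_range_reflect]
  rw [← Finset.sum_add_distrib]
  refine Finset.sum_congr rfl fun i hi => ?_
  have hi : i ≤ f.natDegree := Nat.lt_succ_iff.1 (Finset.mem_range.1 hi)
  have : f.coeff (f.natDegree - i) = f.coeff i := by
    conv_rhs => rw [← hf, coeff_reverse, revAt_le hi]
  rw [Nat.add_sub_cancel, this]
  push_cast [hi]
  ring

theorem two_mul_polyLength_le {F f g : ℤ[X]} {m r : ℕ}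
    (h : F * (1 - X ^ m) = expand ℤ r f * g) (hm : f.natDegree < m) (hr : 2 ≤ r)
    (hF : F.natDegree = f.natDegree * (r - 1)) (hf : f.reverse = f) :
    2 * polyLength F ≤ r * (polyLength f * polyLength g) := by
  have hm0 : 0 < m := by omega
  have h' : (F : PowerSeries ℤ) * (1 - PowerSeries.X ^ m) =
      ((expand ℤ r f * g : ℤ[X]) : PowerSeries ℤ) := by
    rw [← h]; simp
  set d := f.natDegree with hd
  set D := F.natDegree with hD
  have hDd : (D : ℤ) = d * (r - 1) := by
    rw [hF]; push_cast [show 1 ≤ r by omega]; ring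
  have key : (m : ℤ) * polyLength F ≤
      ∑ i ∈ Finset.range (d + 1), ∑ j ∈ Finset.range (g.natDegree + 1),
        |f.coeff i| * |g.coeff j| * ((D : ℤ) - r * i + m) := by
    rw [polyLength_eq_sum_range (Nat.lt_succ_self _)]
    calc (m : ℤ) * ∑ n ∈ Finset.range (D + 1), |F.coeff n|
        ≤ (m : ℤ) * ∑ n ∈ Finset.range (D + 1), ∑ i ∈ Finset.range (d + 1),
            ∑ j ∈ Finset.range (g.natDegree + 1), ∑ k ∈ Finset.range (D + 1),
            |f.coeff i| * |g.coeff j| * (if r * i + j + m * k = n then 1 else 0 : ℤ) := by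
          refine mul_le_mul_of_nonneg_left (Finset.sum_le_sum fun n hn => ?_) (by positivity)
          rw [Finset.mem_range] at hn
          rw [← Polynomial.coeff_coe, coeff_eq_sum_of_mul_one_sub h' (Nat.lt_succ_self _)
            (Nat.lt_succ_self _) (K := D + 1) (by nlinarith)]
          refine (Finset.abs_sum_le_sum_abs _ _).trans (Finset.sum_le_sum fun i _ => ?_)
          refine (Finset.abs_sum_le_sum_abs _ _).trans (Finset.sum_le_sum fun j _ => ?_)
          refine (Finset.abs_sum_le_sum_abs _ _).trans (Finset.sum_le_sum fun k _ => ?_)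
          split_ifs
          · rw [abs_mul, mul_one]
          · simp
      _ = ∑ i ∈ Finset.range (d + 1), ∑ j ∈ Finset.range (g.natDegree + 1),
            |f.coeff i| * |g.coeff j| * ((m : ℤ) * ∑ n ∈ Finset.range (D + 1),
              ∑ k ∈ Finset.range (D + 1), (if r * i + j + m * k = n then 1 else 0 : ℤ)) := by
          rw [Finset.sum_comm, Finset.mul_sum]
          refine Finset.sum_congr rfl fun i _ => ?_
          rw [Finset.sum_comm, Finset.mul_sum]
          refine Finset.sum_congr rfl fun j _ => ?_
          simp only [← Finset.mul_sum]
          ring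
      _ ≤ _ := by
          refine Finset.sum_le_sum fun i hi => Finset.sum_le_sum fun j _ => ?_
          refine mul_le_mul_of_nonneg_left ((sum_ite_add_mul_le hm0).trans ?_) (by positivity)
          rw [Finset.mem_range] at hi
          have hi : (i : ℤ) ≤ d := by omega
          have hmd : (d : ℤ) < m := by exact_mod_cast hm
          have hr0 : (0 : ℤ) ≤ r := by positivity
          refine max_le ?_ (by push_cast; linarith)
          rw [hDd]
          nlinarith
  have hsum : ∑ i ∈ Finset.range (d + 1), ∑ j ∈ Finset.range (g.natDegree + 1),
        |f.coeff i| * |g.coeff j| * ((D : ℤ) - r * i + m) =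
      polyLength g * ((D + m) * polyLength f -
        r * ∑ i ∈ Finset.range (d + 1), |f.coeff i| * i) := by
    rw [polyLength_eq_sum_range (f := g) (Nat.lt_succ_self _),
      polyLength_eq_sum_range (f := f) (Nat.lt_succ_self _), Finset.mul_sum, Finset.mul_sum,
      ← Finset.sum_sub_distrib, Finset.sum_mul_sum, Finset.sum_comm]
    exact Finset.sum_congr rfl fun i _ => Finset.sum_congr rfl fun j _ => by ring
  rw [hsum] at key
  have hsym := two_mul_sum_abs_coeff_mul hf
  have hfg : 0 ≤ polyLength f * polyLength g :=
    mul_nonneg (polyLength_nonneg _) (polyLength_nonneg _)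
  have hmd : (d : ℤ) ≤ m := by exact_mod_cast hm.le
  have hr2 : (2 : ℤ) ≤ r := by exact_mod_cast hr
  have hm' : (0 : ℤ) < m := by exact_mod_cast hm0
  refine le_of_mul_le_mul_left ?_ hm'
  calc (m : ℤ) * (2 * polyLength F)
      ≤ polyLength f * polyLength g * (2 * D + 2 * m - r * d) := by
        linear_combination 2 * key - r * polyLength g * hsym
    _ ≤ polyLength f * polyLength g * (r * m) := by
        refine mul_le_mul_of_nonneg_left ?_ hfg
        rw [hDd]
        nlinarith [mul_nonneg (sub_nonneg.2 hmd) (sub_nonneg.2 hr2)]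
    _ = m * (r * (polyLength f * polyLength g)) := by ring

theorem reverse_geom_sum (n : ℕ) :
    (∑ i ∈ Finset.range n, X ^ i : ℤ[X]).reverse = ∑ i ∈ Finset.range n, X ^ i := by
  rcases n.eq_zero_or_pos with rfl | hn
  · simp
  have hc : ∀ j, (∑ i ∈ Finset.range n, X ^ i : ℤ[X]).coeff j = if j < n then 1 else 0 := by
    intro j
    simp [finsetSum_coeff, coeff_X_pow]
  have hd : (∑ i ∈ Finset.range n, X ^ i : ℤ[X]).natDegree = n - 1 := by
    apply le_antisymm
    · refine natDegree_le_iff_coeff_eq_zero.2 fun j hj => ?_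
      rw [hc, if_neg (by omega)]
    · refine le_natDegree_of_ne_zero ?_
      rw [hc, if_pos (by omega)]
      exact one_ne_zero
  ext j
  rw [coeff_reverse, hd, hc, hc]
  by_cases hj : j ≤ n - 1
  · rw [revAt_le hj, if_pos (by omega), if_pos (by omega)]
  · rw [revAt_eq_self_of_lt (by omega)]

theorem reverse_prod {ι : Type*} (s : Finset ι) (f : ι → ℤ[X]) :
    (∏ i ∈ s, f i).reverse = ∏ i ∈ s, (f i).reverse := by
  induction s using Finset.cons_induction with
  | empty => simpa using reverse_C (1 : ℤ)
  | cons a s ha ih => rw [Finset.prod_cons, Finset.prod_cons, reverse_mul_of_domain, ih]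

theorem reverse_cyclotomic {n : ℕ} (hn : 1 < n) :
    (cyclotomic n ℤ).reverse = cyclotomic n ℤ := by
  induction n using Nat.strong_induction_on with
  | _ n ih =>
    have hmem : n ∈ n.divisors.erase 1 := by
      simp only [Finset.mem_erase, Nat.mem_divisors]
      exact ⟨by omega, dvd_rfl, by omega⟩
    have h := prod_cyclotomic_eq_geom_sum (show 0 < n by omega) ℤ
    have hr := congrArg reverse h
    rw [reverse_geom_sum, ← h, reverse_prod, ← Finset.mul_prod_erase _ _ hmem,
      ← Finset.mul_prod_erase _ _ hmem] at hr
    rw [Finset.prod_congr rfl fun d hd => ?_] at hr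
    · refine mul_right_cancel₀ (Finset.prod_ne_zero_iff.2 fun d _ => cyclotomic_ne_zero d ℤ) hr
    · simp only [Finset.mem_erase, Nat.mem_divisors] at hd
      have hdpos : 0 < d := Nat.pos_of_dvd_of_pos hd.2.2.1 (by omega)
      have hdle := Nat.le_of_dvd (by omega) hd.2.2.1
      exact ih d (by omega) (by omega)

/-- The inverse cyclotomic polynomial `(X ^ n - 1) / Φ_n`. -/
noncomputable def invCyclotomic (n : ℕ) : ℤ[X] := (X ^ n - 1) /ₘ cyclotomic n ℤ

theorem cyclotomic_mul_invCyclotomic (n : ℕ) :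
    cyclotomic n ℤ * invCyclotomic n = X ^ n - 1 := by
  obtain ⟨c, hc⟩ := cyclotomic.dvd_X_pow_sub_one n ℤ
  rw [invCyclotomic, hc, mul_divByMonic_cancel_left _ (cyclotomic.monic n ℤ)]

theorem cyclotomic_mul_prime {m r : ℕ} (hr : r.Prime) (h : ¬ r ∣ m) :
    cyclotomic (m * r) ℤ * cyclotomic m ℤ = expand ℤ r (cyclotomic m ℤ) :=
  (cyclotomic_expand_eq_cyclotomic_mul hr h ℤ).symm

theorem invCyclotomic_mul_prime {m r : ℕ} (hr : r.Prime) (h : ¬ r ∣ m) :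
    invCyclotomic (m * r) = cyclotomic m ℤ * expand ℤ r (invCyclotomic m) := by
  refine mul_left_cancel₀ (cyclotomic_ne_zero (m * r) ℤ) ?_
  rw [cyclotomic_mul_invCyclotomic, ← mul_assoc, cyclotomic_mul_prime hr h, ← map_mul,
    cyclotomic_mul_invCyclotomic]
  simp [← pow_mul, mul_comm]

theorem cyclotomic_mul_prime_mul_one_sub {m r : ℕ} (hr : r.Prime) (h : ¬ r ∣ m) :
    cyclotomic (m * r) ℤ * (1 - X ^ m) = expand ℤ r (cyclotomic m ℤ) * -invCyclotomic m := by
  rw [← cyclotomic_mul_prime hr h, ← neg_sub, ← cyclotomic_mul_invCyclotomic]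
  ring

theorem natDegree_cyclotomic_lt {m : ℕ} (hm : 1 < m) : (cyclotomic m ℤ).natDegree < m := by
  rw [natDegree_cyclotomic]
  exact Nat.totient_lt m hm

theorem polyLength_invCyclotomic_mul_prime_le {m r : ℕ} (hr : r.Prime) (h : ¬ r ∣ m) :
    polyLength (invCyclotomic (m * r)) ≤
      polyLength (cyclotomic m ℤ) * polyLength (invCyclotomic m) := by
  rw [invCyclotomic_mul_prime hr h]
  exact (polyLength_mul_le _ _).trans
    (mul_le_mul_of_nonneg_left (polyLength_expand_le _ _) (polyLength_nonneg _))

theorem two_mul_polyLength_cyclotomic_mul_prime_le {m r : ℕ} (hm : 1 < m) (hr : r.Prime)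
    (h : ¬ r ∣ m) :
    2 * polyLength (cyclotomic (m * r) ℤ) ≤
      r * (polyLength (cyclotomic m ℤ) * polyLength (invCyclotomic m)) := by
  rw [← polyLength_neg (invCyclotomic m)]
  refine two_mul_polyLength_le (cyclotomic_mul_prime_mul_one_sub hr h)
    (natDegree_cyclotomic_lt hm) hr.two_le ?_ (reverse_cyclotomic hm)
  rw [natDegree_cyclotomic, natDegree_cyclotomic,
    Nat.totient_mul (((Nat.Prime.coprime_iff_not_dvd hr).2 h).symm), Nat.totient_prime hr]

theorem abs_coeff_cyclotomic_mul_prime_le {m r : ℕ} {A : ℤ} (hm : 1 < m) (hr : r.Prime)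
    (h : ¬ r ∣ m) (hA : ∀ n, |(cyclotomic m ℤ).coeff n| ≤ A) (n : ℕ) :
    |(cyclotomic (m * r) ℤ).coeff n| ≤ A * polyLength (invCyclotomic m) := by
  rw [← polyLength_neg (invCyclotomic m), ← Polynomial.coeff_coe]
  refine abs_coeff_le_of_mul_one_sub (m := m) (r := r) ?_
    ((Nat.Prime.coprime_iff_not_dvd hr).2 h).symm (natDegree_cyclotomic_lt hm) hA n
  rw [← cyclotomic_mul_prime_mul_one_sub hr h]
  simp

theorem invCyclotomic_prime {p : ℕ} (hp : p.Prime) : invCyclotomic p = X - 1 := by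
  have := Fact.mk hp
  refine mul_left_cancel₀ (cyclotomic_ne_zero p ℤ) ?_
  rw [cyclotomic_mul_invCyclotomic, cyclotomic_prime_mul_X_sub_one]

theorem polyLength_invCyclotomic_prime_mul_prime_le {p q : ℕ} (hp : p.Prime) (hq : q.Prime)
    (hpq : p ≠ q) : polyLength (invCyclotomic (p * q)) ≤ 2 * p := by
  have hl : polyLength (cyclotomic p ℤ) ≤ p := by
    have := Fact.mk hp
    rw [cyclotomic_prime]
    simpa using polyLength_sum_X_pow_le (Finset.range p) id
  have hi : polyLength (invCyclotomic p) ≤ 2 := by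
    rw [invCyclotomic_prime hp]
    refine (polyLength_sub_le _ _).trans ?_
    have h1 := polyLength_X_pow 1
    have h0 := polyLength_X_pow 0
    rw [pow_one] at h1
    rw [pow_zero] at h0
    omega
  refine (polyLength_invCyclotomic_mul_prime_le hq
    fun h => hpq ((Nat.prime_dvd_prime_iff_eq hq hp).1 h).symm).trans ?_
  nlinarith [polyLength_nonneg (cyclotomic p ℤ), polyLength_nonneg (invCyclotomic p)]

theorem cyclotomic_prime_mul_prime_mul {p q : ℕ} (hp : p.Prime) (hq : q.Prime) (hpq : p ≠ q) :
    cyclotomic (p * q) ℤ * ((1 - X ^ p) * (1 - X ^ q)) = (1 - X) * (1 - X ^ (p * q)) := by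
  have h1 := cyclotomic_mul_prime (m := p) hq
    fun h => hpq ((Nat.prime_dvd_prime_iff_eq hq hp).1 h).symm
  have := Fact.mk hp
  have h2 := cyclotomic_prime_mul_X_sub_one ℤ p
  have h3 := congrArg (expand ℤ q) h2
  rw [map_mul, ← h1] at h3
  simp only [map_sub, map_pow, expand_X, map_one, ← pow_mul] at h3
  rw [mul_comm p q, ← neg_sub (X ^ (q * p)), ← h3, ← neg_sub (X ^ p), ← h2]
  rw [mul_comm p q]
  ring

theorem two_mul_polyLength_cyclotomic_prime_mul_prime_le {p q : ℕ} (hp : p.Prime)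
    (hq : q.Prime) (hpq : p ≠ q) :
    2 * polyLength (cyclotomic (p * q) ℤ) ≤ p * q := by
  obtain ⟨a, b, ha, hb, hab⟩ : ∃ a b : ℕ, a ≤ q ∧ b ≤ p ∧ a * p + b * q = p * q + 1 := by
    have hco : Nat.Coprime p q := (Nat.coprime_primes hp hq).2 hpq
    obtain ⟨a, haq, ha⟩ := Nat.exists_mul_mod_eq_one_of_coprime hco hq.one_lt
    have hdm := Nat.div_add_mod (p * a) q
    have hk : p * a / q < p := by
      rw [Nat.div_lt_iff_lt_mul hq.pos]
      exact Nat.mul_lt_mul_of_pos_left haq hp.pos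
    refine ⟨a, p - p * a / q, haq.le, Nat.sub_le _ _, ?_⟩
    zify [hk.le]
    zify at hdm ha
    linear_combination -hdm + ha
  have hid : cyclotomic (p * q) ℤ =
      (∑ i ∈ Finset.range a, X ^ (p * i)) * (∑ j ∈ Finset.range b, X ^ (q * j)) -
      X ^ 1 * ((∑ i ∈ Finset.range (q - a), X ^ (p * i)) *
        (∑ j ∈ Finset.range (p - b), X ^ (q * j))) := by
    have hne : ∀ k : ℕ, k.Prime → (1 - X ^ k : ℤ[X]) ≠ 0 := fun k hk h => by
      have := congrArg (fun f : ℤ[X] => f.coeff 0) h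
      simp [coeff_X_pow, hk.ne_zero.symm] at this
    refine mul_right_cancel₀ (mul_ne_zero (hne p hp) (hne q hq)) ?_
    rw [cyclotomic_prime_mul_prime_mul hp hq hpq]
    have g : ∀ k c : ℕ, (∑ i ∈ Finset.range c, X ^ (k * i) : ℤ[X]) * (1 - X ^ k) =
        1 - X ^ (k * c) := fun k c => by
      simp only [pow_mul]
      exact geom_sum_mul_neg _ _
    have e1 : (X ^ (p * q) * X : ℤ[X]) = X ^ (p * a) * X ^ (q * b) := by
      rw [← pow_succ, ← pow_add, ← hab]; ring
    have e2 : (X * X ^ (p * (q - a)) : ℤ[X]) = X ^ (q * b) := by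
      rw [← pow_succ']; congr 1; zify [ha]; zify at hab; linear_combination -hab
    have e3 : (X * X ^ (q * (p - b)) : ℤ[X]) = X ^ (p * a) := by
      rw [← pow_succ']; congr 1; zify [hb]; zify at hab; linear_combination -hab
    have e4 : (X * (X ^ (p * (q - a)) * X ^ (q * (p - b))) : ℤ[X]) = X ^ (p * q) := by
      rw [← pow_add, ← pow_succ']; congr 1; zify [ha, hb]; zify at hab
      linear_combination -hab
    linear_combination -(g p a) * (∑ j ∈ Finset.range b, X ^ (q * j)) * (1 - X ^ q)
      - (1 - X ^ (p * a)) * g q b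
      + X * g p (q - a) * (∑ j ∈ Finset.range (p - b), X ^ (q * j)) * (1 - X ^ q)
      + X * (1 - X ^ (p * (q - a))) * g q (p - b) + e1 - e2 - e3 + e4
  have hl : polyLength (cyclotomic (p * q) ℤ) ≤ a * b + (q - a) * (p - b) := by
    have hs : ∀ k c : ℕ, polyLength (∑ i ∈ Finset.range c, X ^ (k * i)) ≤ c := fun k c => by
      simpa using polyLength_sum_X_pow_le (Finset.range c) (k * ·)
    have hm : ∀ k c k' c' : ℕ, polyLength ((∑ i ∈ Finset.range c, X ^ (k * i)) *
        ∑ i ∈ Finset.range c', X ^ (k' * i)) ≤ c * c' := fun k c k' c' =>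
      (polyLength_mul_le _ _).trans
        (mul_le_mul (hs k c) (hs k' c') (polyLength_nonneg _) (by positivity))
    rw [hid]
    refine (polyLength_sub_le _ _).trans (add_le_add (hm _ _ _ _) ?_)
    refine (polyLength_mul_le _ _).trans ?_
    rw [polyLength_X_pow, one_mul, ← Nat.cast_sub ha, ← Nat.cast_sub hb]
    exact hm _ _ _ _
  zify at hab
  have hpq0 : (0 : ℤ) < p * q := by have := hp.pos; have := hq.pos; positivity
  have hpq2 : (2 : ℤ) ≤ p * q := by exact_mod_cast hp.two_le.trans (Nat.le_mul_of_pos_right _ hq.pos)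
  have h4 : 4 * ((a : ℤ) * b) * (p * q) ≤ (p * q + 1) ^ 2 := by
    rw [← hab]; nlinarith [sq_nonneg ((a : ℤ) * p - b * q)]
  have h5 : 4 * ((a : ℤ) * b) < p * q + 3 := by
    by_contra! hcon
    nlinarith [mul_le_mul_of_nonneg_right hcon hpq0.le]
  linarith

theorem coeff_mem_Icc_of_mul_one_sub {p q : ℕ} (hq : q.Prime) (hp : p.Prime) (hpq : p ≠ q)
    {G : PowerSeries ℤ}
    (hG : (1 - PowerSeries.X) * G = (cyclotomic (p * q) ℤ : PowerSeries ℤ)) (n : ℕ) :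
    PowerSeries.coeff n G ∈ Set.Icc (0 : ℤ) 1 := by
  have hne : ∀ k : ℕ, k ≠ 0 → (1 - PowerSeries.X ^ k : PowerSeries ℤ) ≠ 0 := fun k hk h => by
    have := congrArg (PowerSeries.coeff 0) h
    rw [map_sub, PowerSeries.coeff_X_pow, if_neg hk.symm] at this
    simp at this
  have hcyc := congrArg (fun f : ℤ[X] => (f : PowerSeries ℤ))
    (cyclotomic_prime_mul_prime_mul hp hq hpq)
  have hgeom := congrArg (fun f : ℤ[X] => (f : PowerSeries ℤ))
    (geom_sum_mul_neg (X ^ q : ℤ[X]) p)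
  have hexp : expand ℤ q (∑ i ∈ Finset.range p, X ^ i : ℤ[X]) =
      ∑ i ∈ Finset.range p, (X ^ q) ^ i := by simp
  rw [← hexp] at hgeom
  simp only [Polynomial.coe_mul, Polynomial.coe_sub, Polynomial.coe_one, Polynomial.coe_pow,
    Polynomial.coe_X] at hcyc hgeom
  have hF : G * (1 - PowerSeries.X ^ p) =
      ((expand ℤ q (∑ i ∈ Finset.range p, X ^ i : ℤ[X]) * 1 : ℤ[X]) : PowerSeries ℤ) := by
    rw [mul_one]
    refine mul_right_cancel₀ (hne q hq.ne_zero) (mul_left_cancel₀ (hne 1 one_ne_zero) ?_)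
    rw [hgeom, pow_one, ← pow_mul, mul_comm q p]
    rw [← hG] at hcyc
    linear_combination hcyc
  have hc : ∀ j, (∑ i ∈ Finset.range p, X ^ i : ℤ[X]).coeff j = if j < p then 1 else 0 := by
    intro j
    simp [finsetSum_coeff, coeff_X_pow]
  have hd : (∑ i ∈ Finset.range p, X ^ i : ℤ[X]).natDegree < p := by
    rw [Nat.lt_iff_le_pred hp.pos]
    refine natDegree_le_iff_coeff_eq_zero.2 fun j hj => ?_
    rw [hc, if_neg (by omega)]
  have hform := coeff_eq_sum_of_mul_one_sub hF hd (J := 1) (by simp) (K := n + 1) (n := n)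
    (by have := hp.pos; nlinarith)
  have heq : PowerSeries.coeff n G = ∑ i ∈ Finset.range p, ∑ k ∈ Finset.range (n + 1),
      (if q * i + 0 + p * k = n then 1 else 0 : ℤ) := by
    rw [hform]
    refine Finset.sum_congr rfl fun i hi => ?_
    rw [Finset.sum_range_one]
    refine Finset.sum_congr rfl fun k _ => ?_
    rw [hc, if_pos (Finset.mem_range.1 hi)]
    simp
  rw [heq]
  exact ⟨Finset.sum_nonneg fun i _ => Finset.sum_nonneg fun k _ => by split_ifs <;> simp,
    sum_ite_mul_add_le_one hp.pos ((Nat.coprime_primes hp hq).2 hpq) 0 n _⟩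

theorem one_sub_X_mul_mk_coeff_div {p : ℕ} (hp : 0 < p) {f : ℤ[X]} {G : PowerSeries ℤ}
    (hG : (1 - PowerSeries.X) * G = (f : PowerSeries ℤ)) :
    (1 - PowerSeries.X) * PowerSeries.mk (fun n => PowerSeries.coeff (n / p) G) =
      (expand ℤ p f : PowerSeries ℤ) := by
  have hcoeff : ∀ n, f.coeff n = PowerSeries.coeff n G -
      if 1 ≤ n then PowerSeries.coeff (n - 1) G else 0 := fun n => by
    rw [← Polynomial.coeff_coe, ← hG, sub_mul, one_mul, map_sub, ← pow_one PowerSeries.X,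
      PowerSeries.coeff_X_pow_mul']
  ext n
  rw [sub_mul, one_mul, map_sub, ← pow_one PowerSeries.X, PowerSeries.coeff_X_pow_mul',
    Polynomial.coeff_coe, coeff_expand hp, hcoeff, PowerSeries.coeff_mk, PowerSeries.coeff_mk]
  rcases n with _ | n
  · simp
  · rw [if_pos (by omega), Nat.add_sub_cancel, Nat.succ_div]
    by_cases h : p ∣ n + 1
    · simp [h]
    · simp [h]

theorem abs_coeff_cyclotomic_three_primes_le {p q r : ℕ} (hp : p.Prime) (hq : q.Prime)
    (hr : r.Prime) (hpq : p ≠ q) (hpr : p ≠ r) (hqr : q ≠ r) (n : ℕ) :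
    |(cyclotomic (q * r * p) ℤ).coeff n| ≤ p := by
  have hdvd : ¬ p ∣ q * r := fun h => (hp.dvd_mul.1 h).elim
    (fun h => hpq ((Nat.prime_dvd_prime_iff_eq hp hq).1 h))
    (fun h => hpr ((Nat.prime_dvd_prime_iff_eq hp hr).1 h))
  have hqr0 : 0 < q * r := Nat.mul_pos hq.pos hr.pos
  have h1 : 1 < q * r * p := by
    have := hp.two_le
    nlinarith
  set G : PowerSeries ℤ := PowerSeries.mk 1 * (cyclotomic (q * r) ℤ : PowerSeries ℤ) with hGdef
  have hG : (1 - PowerSeries.X) * G = (cyclotomic (q * r) ℤ : PowerSeries ℤ) := by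
    rw [hGdef, ← mul_assoc, mul_comm (1 - PowerSeries.X), PowerSeries.mk_one_mul_one_sub_eq_one,
      one_mul]
  set T : PowerSeries ℤ := PowerSeries.mk (fun n => PowerSeries.coeff (n / p) G) with hT
  have hTX := one_sub_X_mul_mk_coeff_div hp.pos hG
  rw [← hT] at hTX
  have hT01 : ∀ n, PowerSeries.coeff n T ∈ Set.Icc (0 : ℤ) 1 := fun n => by
    rw [hT, PowerSeries.coeff_mk]
    exact coeff_mem_Icc_of_mul_one_sub hr hq hqr hG _
  set V : PowerSeries ℤ := T * (1 - PowerSeries.X ^ q) * (1 - PowerSeries.X ^ r) with hV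
  have hV2 : ∀ n, |PowerSeries.coeff n V| ≤ 2 := fun n => by
    rw [hV, mul_sub, mul_one, mul_sub, mul_one]
    simp only [map_sub, PowerSeries.coeff_mul_X_pow']
    have e1 := hT01 n
    have e2 := hT01 (n - q)
    have e3 := hT01 (n - r)
    have e4 := hT01 (n - r - q)
    rw [Set.mem_Icc] at e1 e2 e3 e4
    rw [abs_le]
    split_ifs <;> constructor <;> linarith
  have hmain : (cyclotomic (q * r * p) ℤ : PowerSeries ℤ) * (1 - PowerSeries.X ^ (q * r)) = V := by
    have hcyc := congrArg (fun f : ℤ[X] => (f : PowerSeries ℤ))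
      (cyclotomic_prime_mul_prime_mul hq hr hqr)
    have hexp := congrArg (fun f : ℤ[X] => (f : PowerSeries ℤ)) (cyclotomic_mul_prime hp hdvd)
    simp only [Polynomial.coe_mul, Polynomial.coe_sub, Polynomial.coe_one, Polynomial.coe_pow,
      Polynomial.coe_X] at hcyc hexp
    have hne : (1 - PowerSeries.X : PowerSeries ℤ) ≠ 0 := fun h => by
      have := congrArg (PowerSeries.coeff 0) h
      simp at this
    refine mul_left_cancel₀ hne ?_
    rw [hV]
    linear_combination (-(cyclotomic (q * r * p) ℤ : PowerSeries ℤ)) * hcyc +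
      (1 - PowerSeries.X ^ q) * (1 - PowerSeries.X ^ r) * (hexp - hTX)
  have hbound : ∀ n, |(cyclotomic (q * r * p) ℤ).coeff n| ≤ 2 * ((n / (q * r) : ℕ) + 1) := by
    intro n
    induction n using Nat.strong_induction_on with
    | _ n ih =>
      have hn := congrArg (PowerSeries.coeff n) hmain
      rw [mul_sub, mul_one, map_sub, PowerSeries.coeff_mul_X_pow', Polynomial.coeff_coe,
        Polynomial.coeff_coe] at hn
      have hVn := abs_le.1 (hV2 n)
      by_cases hle : q * r ≤ n
      · rw [if_pos hle] at hn
        have hi := abs_le.1 (ih (n - q * r) (by omega))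
        rw [Nat.div_eq_sub_div hqr0 hle, abs_le]
        rw [Nat.cast_succ]
        constructor <;> linarith
      · rw [if_neg hle] at hn
        rw [Nat.div_eq_of_lt (by omega), abs_le]
        constructor <;> push_cast <;> linarith
  have hdeg : (cyclotomic (q * r * p) ℤ).natDegree < q * r * (p - 1) := by
    rw [natDegree_cyclotomic,
      Nat.totient_mul (((Nat.Prime.coprime_iff_not_dvd hp).2 hdvd).symm), Nat.totient_prime hp]
    refine Nat.mul_lt_mul_of_pos_right (Nat.totient_lt _ ?_) (by have := hp.two_le; omega)
    have := hq.two_le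
    have := hr.two_le
    nlinarith
  have hlow : ∀ n, 2 * n ≤ (cyclotomic (q * r * p) ℤ).natDegree →
      |(cyclotomic (q * r * p) ℤ).coeff n| ≤ p := by
    intro n hn
    refine (hbound n).trans ?_
    have h2 : q * r * (n / (q * r)) ≤ n := Nat.mul_div_le _ _
    have h3 : 2 * (n / (q * r)) < p - 1 :=
      lt_of_mul_lt_mul_left (show q * r * (2 * (n / (q * r))) < q * r * (p - 1) by linarith)
        (Nat.zero_le _)
    omega
  by_cases hn : n ≤ (cyclotomic (q * r * p) ℤ).natDegree
  · by_cases hn2 : 2 * n ≤ (cyclotomic (q * r * p) ℤ).natDegree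
    · exact hlow n hn2
    · rw [← reverse_cyclotomic h1, coeff_reverse, revAt_le hn]
      exact hlow _ (by omega)
  · rw [coeff_eq_zero_of_natDegree_lt (by omega), abs_zero]
    positivity

/-- **(Bzdęga, bound (6)).** For odd primes `p < q < r < s < t < u`,
`C (pqrstu) ≤ (10935/131072)·p¹⁵q⁷r³s`. -/
theorem height_cyclotomic_stmt14 (p q r s t u : ℕ)
    (hp : p.Prime) (hq : q.Prime) (hr : r.Prime) (hs : s.Prime) (ht : t.Prime) (hu : u.Prime)
    (hop : Odd p) (hoq : Odd q) (hor : Odd r) (hos : Odd s) (hot : Odd t) (hou : Odd u)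
    (hpq : p < q) (hqr : q < r) (hrs : r < s) (hst : s < t) (htu : t < u) :
    (Cinv (p * q * r * s * t * u) : ℝ) ≤
      (10935 / 131072) * (p : ℝ) ^ 15 * (q : ℝ) ^ 7 * (r : ℝ) ^ 3 * s := by
  have not_dvd : ∀ {a b m : ℕ}, a.Prime → b.Prime → b ≠ a → ¬ b ∣ m → ¬ b ∣ m * a :=
    fun ha hb hne hm h => (hb.dvd_mul.1 h).elim hm
      fun h => hne ((Nat.prime_dvd_prime_iff_eq hb ha).1 h)
  have not_dvd_prime : ∀ {a b : ℕ}, a.Prime → b.Prime → b ≠ a → ¬ b ∣ a :=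
    fun ha hb hne h => hne ((Nat.prime_dvd_prime_iff_eq hb ha).1 h)
  have hrd : ¬ r ∣ p * q := not_dvd hq hr (by omega) (not_dvd_prime hp hr (by omega))
  have hsd : ¬ s ∣ p * q * r := not_dvd hr hs (by omega)
    (not_dvd hq hs (by omega) (not_dvd_prime hp hs (by omega)))
  have htd : ¬ t ∣ p * q * r * s := not_dvd hs ht (by omega) (not_dvd hr ht (by omega)
    (not_dvd hq ht (by omega) (not_dvd_prime hp ht (by omega))))
  have hud : ¬ u ∣ p * q * r * s * t := not_dvd ht hu (by omega) (not_dvd hs hu (by omega)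
    (not_dvd hr hu (by omega) (not_dvd hq hu (by omega) (not_dvd_prime hp hu (by omega)))))
  have one_lt : ∀ {a m : ℕ}, a.Prime → 1 < m → 1 < m * a := fun ha hm =>
    hm.trans_le (Nat.le_mul_of_pos_right _ ha.pos)
  have h2 : 1 < p * q := one_lt hq hp.one_lt
  have h3 : 1 < p * q * r := one_lt hr h2
  have h4 : 1 < p * q * r * s := one_lt hs h3
  have hL2 := two_mul_polyLength_cyclotomic_prime_mul_prime_le hp hq hpq.ne
  have hI2 := polyLength_invCyclotomic_prime_mul_prime_le hp hq hpq.ne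
  have hLI2 : polyLength (cyclotomic (p * q) ℤ) * polyLength (invCyclotomic (p * q)) ≤
      p ^ 2 * q := by
    have := mul_le_mul hL2 hI2 (polyLength_nonneg _) (by positivity)
    refine le_of_mul_le_mul_left (a := (2 : ℤ)) ?_ (by norm_num)
    linear_combination this
  have hL3 : 2 * polyLength (cyclotomic (p * q * r) ℤ) ≤ p ^ 2 * q * r := by
    have := two_mul_polyLength_cyclotomic_mul_prime_le h2 hr hrd
    linear_combination this + (r : ℤ) * hLI2
  have hI3 : polyLength (invCyclotomic (p * q * r)) ≤ p ^ 2 * q := by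
    have := polyLength_invCyclotomic_mul_prime_le hr hrd
    linear_combination this + hLI2
  have hLI3 : 2 * (polyLength (cyclotomic (p * q * r) ℤ) *
      polyLength (invCyclotomic (p * q * r))) ≤ p ^ 4 * q ^ 2 * r := by
    linear_combination mul_le_mul hL3 hI3 (polyLength_nonneg _) (by positivity)
  have hL4 : 4 * polyLength (cyclotomic (p * q * r * s) ℤ) ≤ p ^ 4 * q ^ 2 * r * s := by
    have := two_mul_polyLength_cyclotomic_mul_prime_le h3 hs hsd
    linear_combination 2 * this + (s : ℤ) * hLI3
  have hI4 : 2 * polyLength (invCyclotomic (p * q * r * s)) ≤ p ^ 4 * q ^ 2 * r := by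
    have := polyLength_invCyclotomic_mul_prime_le hs hsd
    linear_combination 2 * this + hLI3
  have hLI4 : 8 * (polyLength (cyclotomic (p * q * r * s) ℤ) *
      polyLength (invCyclotomic (p * q * r * s))) ≤ p ^ 8 * q ^ 4 * r ^ 2 * s := by
    linear_combination mul_le_mul hL4 hI4
      (mul_nonneg (by norm_num) (polyLength_nonneg _)) (by positivity)
  have hI5 : 8 * polyLength (invCyclotomic (p * q * r * s * t)) ≤ p ^ 8 * q ^ 4 * r ^ 2 * s := by
    have := polyLength_invCyclotomic_mul_prime_le ht htd
    linear_combination 8 * this + hLI4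
  have hA3 : ∀ n, |(cyclotomic (p * q * r) ℤ).coeff n| ≤ p := by
    rw [show p * q * r = q * r * p by ring]
    exact abs_coeff_cyclotomic_three_primes_le hp hq hr (by omega) (by omega) (by omega)
  have hA4 : ∀ n, |(cyclotomic (p * q * r * s) ℤ).coeff n| ≤ p ^ 3 * q := fun n => by
    have := abs_coeff_cyclotomic_mul_prime_le h3 hs hsd hA3 n
    linear_combination this + (p : ℤ) * hI3
  have hH : ∀ n, 16 * |(invCyclotomic (p * q * r * s * t * u)).coeff n| ≤
      p ^ 15 * q ^ 7 * r ^ 3 * s := fun n => by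
    have hA5 := abs_coeff_cyclotomic_mul_prime_le h4 ht htd hA4
    rw [invCyclotomic_mul_prime hu hud]
    have hcoeff := abs_coeff_mul_le hA5 (expand ℤ u (invCyclotomic (p * q * r * s * t))) n
    have hlen := polyLength_expand_le u (invCyclotomic (p * q * r * s * t))
    have hI45 := mul_le_mul hI4 hI5 (mul_nonneg (by norm_num) (polyLength_nonneg _)) (by positivity)
    have hbound : 0 ≤ (p : ℤ) ^ 3 * q * polyLength (invCyclotomic (p * q * r * s)) :=
      mul_nonneg (by positivity) (polyLength_nonneg _)
    have hmul := mul_le_mul_of_nonneg_left hlen hbound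
    linear_combination 16 * hcoeff + 16 * hmul + p ^ 3 * q * hI45
  have hC : 16 * Cinv (p * q * r * s * t * u) ≤ p ^ 15 * q ^ 7 * r ^ 3 * s := by
    rw [mul_comm 16, ← Nat.le_div_iff_mul_le (by norm_num)]
    refine Finset.sup_le fun n _ => ?_
    rw [Nat.le_div_iff_mul_le (by norm_num), mul_comm _ 16]
    have := hH n
    rw [invCyclotomic, Int.abs_eq_natAbs] at this
    exact_mod_cast this
  have hC' : (16 : ℝ) * Cinv (p * q * r * s * t * u) ≤ p ^ 15 * q ^ 7 * r ^ 3 * s := by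
    exact_mod_cast hC
  have hpos : (0 : ℝ) ≤ p ^ 15 * q ^ 7 * r ^ 3 * s := by positivity
  linarith
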